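/- arXiv:2109.02932 — 2 statements merged into one kernel-verified Lean document; each statement's English description precedes it below -/
import Mathlib

section
/- Let n ≥ 4 be an integer, let a⁽ⁿ⁾(X) = ∑_{i=0}^{n−2} Cᵢ·Xⁱ ∈ ℤ[X] where Cᵢ is the i-th Catalan number, and suppose k ∈ ℤ[X] satisfies (1−X)^(n−1)·k(X) = 1 − X·a⁽ⁿ⁾(X−X²). Then k is a polynomial of degree n−2 which is irreducible in ℚ[X]. -/
open Polynomial

/-- The Hermite form `[f]` of an integer polynomial viewed as degree `n`:
`f₀^(n-1) · ∏ᵢ (αᵢ^(n-1) X₁ + αᵢ^(n-2) X₂ + ⋯ + X_n)`, where the `αᵢ` are the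
complex roots of `f` counted with multiplicity. -/
noncomputable def hermiteForm (n : ℕ) (f : Polynomial ℤ) : MvPolynomial (Fin n) ℂ :=
  MvPolynomial.C ((f.leadingCoeff : ℂ) ^ (n - 1)) *
    (Multiset.map
      (fun α : ℂ => ∑ j : Fin n, MvPolynomial.C (α ^ (n - 1 - (j : ℕ))) * MvPolynomial.X j)
      ((f.map (Int.castRingHom ℂ)).roots)).prod

/-- `f` and `g`, viewed as degree-`n` polynomials, are Hermite equivalent if there are
`U ∈ GL_n(ℤ)` and `ε ∈ {1,-1}` with `[g](U·X) = ε·[f](X)`. -/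
def HermiteEquiv (n : ℕ) (f g : Polynomial ℤ) : Prop :=
  ∃ (U : Matrix (Fin n) (Fin n) ℤ) (ε : ℤ), IsUnit U.det ∧ (ε = 1 ∨ ε = -1) ∧
    MvPolynomial.bind₁
        (fun i : Fin n => ∑ j : Fin n, MvPolynomial.C ((U i j : ℂ)) * MvPolynomial.X j)
        (hermiteForm n g)
      = MvPolynomial.C ((ε : ℂ)) * hermiteForm n f

/-- The translate `(f∘M)(X) = ∑ₖ f_k (aX+b)^k (cX+d)^(n-k)` of `f`, viewed as a
degree-`n` polynomial, by the matrix `M = (a b; c d)`. -/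
noncomputable def glTranslate (n : ℕ) (f : Polynomial ℤ) (M : Matrix (Fin 2) (Fin 2) ℤ) : Polynomial ℤ :=
  ∑ k ∈ Finset.range (n + 1),
    Polynomial.C (f.coeff k) * (Polynomial.C (M 0 0) * Polynomial.X + Polynomial.C (M 0 1)) ^ k *
      (Polynomial.C (M 1 0) * Polynomial.X + Polynomial.C (M 1 1)) ^ (n - k)

/-- `f` and `g`, viewed as degree-`n` polynomials, are `GL₂(ℤ)`-equivalent if
`g = ±(f∘M)` for some `M ∈ GL₂(ℤ)`. -/
def GL2Equiv (n : ℕ) (f g : Polynomial ℤ) : Prop :=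
  ∃ M : Matrix (Fin 2) (Fin 2) ℤ, IsUnit M.det ∧
    (g = glTranslate n f M ∨ g = -glTranslate n f M)

/-- The list of complex roots of `f`, counted with multiplicity (in some order). -/
noncomputable def rootList (f : Polynomial ℤ) : List ℂ :=
  ((f.map (Int.castRingHom ℂ)).roots).toList

/-- The discriminant `D(f) = f₀^(2n-2) ∏_{i<j} (αᵢ - α_j)²` of `f` (as a complex number;
it is independent of the ordering of the roots since the product is symmetric). -/
noncomputable def discC (f : Polynomial ℤ) : ℂ :=
  (f.leadingCoeff : ℂ) ^ (2 * f.natDegree - 2) *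
    ∏ p : Fin (rootList f).length × Fin (rootList f).length,
      if (p.1 : ℕ) < (p.2 : ℕ) then ((rootList f).get p.1 - (rootList f).get p.2) ^ 2 else 1

/-- `K_f := ℚ[X]/(f)`. -/
abbrev Kf (f : Polynomial ℤ) : Type := AdjoinRoot (f.map (Int.castRingHom ℚ))

/-- The residue class `α` of `X` in `K_f`. -/
noncomputable def rootOf (f : Polynomial ℤ) : Kf f := AdjoinRoot.root _

/-- `ζᵢ = f₀ αⁱ + f₁ α^(i-1) + ⋯ + f_{i-1} α`, where `f_j` is the coefficient of
`X^(n-j)` in `f`. -/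
noncomputable def zeta (f : Polynomial ℤ) (i : ℕ) : Kf f :=
  ∑ j ∈ Finset.range i, ((f.coeff (f.natDegree - j) : ℤ) : Kf f) * rootOf f ^ (i - j)

/-- The invariant module `I_f(k)`: the ℤ-span of `1, α, …, α^k, ζ_{k+1}, …, ζ_{n-1}`
inside `K_f`.  In particular `R_f = I_f(0)` and `I_f = I_f(1)`. -/
noncomputable def invModule (f : Polynomial ℤ) (k : ℕ) : Submodule ℤ (Kf f) :=
  Submodule.span ℤ
    ({x | ∃ j ≤ k, x = rootOf f ^ j} ∪
     {x | ∃ i, k + 1 ≤ i ∧ i ≤ f.natDegree - 1 ∧ x = zeta f i})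

/-- `f` and `g` are ℤ-equivalent: `g(X) = εⁿ f(εX + a)` with `ε = ±1`, `a ∈ ℤ`. -/
def ZEquiv (f g : Polynomial ℤ) : Prop :=
  ∃ ε a : ℤ, (ε = 1 ∨ ε = -1) ∧
    g = Polynomial.C (ε ^ f.natDegree) * f.comp (Polynomial.C ε * Polynomial.X + Polynomial.C a)

/-- The `(n-2)`-th partial sum `a⁽ⁿ⁾(X) = ∑_{i=0}^{n-2} Cᵢ Xⁱ` of the Catalan
generating function. -/
noncomputable def aPoly (n : ℕ) : Polynomial ℤ :=
  ∑ i ∈ Finset.range (n - 1), Polynomial.C ((catalan i : ℤ)) * Polynomial.X ^ i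

/-- Erdős's bound on the central binomial coefficient, keeping track of the primes in `(n, 2n)`. -/
theorem centralBinom_le_pow_card_primes (n : ℕ) (hn : 2 < n) :
    n.centralBinom ≤ (2 * n) ^ (Nat.sqrt (2 * n) + ((Finset.Ioo n (2 * n)).filter Nat.Prime).card) *
      4 ^ (2 * n / 3) := by
  set P := (Finset.Ioo n (2 * n)).filter Nat.Prime with hP
  set f : ℕ → ℕ := fun p => p ^ n.centralBinom.factorization p with hf
  have hle (p : ℕ) : f p ≤ 2 * n := Nat.pow_factorization_choose_le (by omega)
  have hnp {p : ℕ} (h : ¬ p.Prime) : f p = 1 := by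
    simp [hf, Nat.factorization_eq_zero_of_not_prime _ h]
  have hsplit : n.centralBinom = (∏ p ∈ Finset.range (2 * n / 3 + 1), f p) * ∏ p ∈ P, f p := by
    rw [← Finset.prod_union]
    · rw [← n.prod_pow_factorization_centralBinom]
      symm
      apply Finset.prod_subset
      · intro p hp
        simp only [hP, Finset.mem_union, Finset.mem_range, Finset.mem_filter, Finset.mem_Ioo] at hp ⊢
        omega
      · intro p hp hp'
        by_cases hpr : p.Prime
        · simp only [hP, Finset.mem_union, Finset.mem_range, Finset.mem_filter, Finset.mem_Ioo,
            hpr, and_true] at hp hp'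
          have hne : p ≠ 2 * n := by
            rintro rfl
            exact Nat.not_prime_mul (by norm_num) (by omega) hpr
          have h0 : n.centralBinom.factorization p = 0 :=
            Nat.factorization_centralBinom_of_two_mul_self_lt_three_mul hn (by omega) (by omega)
          simp only [hf, h0, pow_zero]
        · exact hnp hpr
    · rw [Finset.disjoint_left]
      intro p hp hp'
      simp only [hP, Finset.mem_range, Finset.mem_filter, Finset.mem_Ioo] at hp hp'
      omega
  have hlarge : ∏ p ∈ P, f p ≤ (2 * n) ^ P.card := Finset.prod_le_pow_card _ _ _ fun p _ => hle p
  have hsmall : ∏ p ∈ Finset.range (2 * n / 3 + 1), f p ≤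
      (2 * n) ^ Nat.sqrt (2 * n) * 4 ^ (2 * n / 3) := by
    rw [← Finset.prod_filter_of_ne (p := Nat.Prime) fun p _ h => by
      contrapose! h; exact hnp h]
    rw [← Finset.prod_filter_mul_prod_filter_not _ (· ≤ Nat.sqrt (2 * n))]
    apply mul_le_mul'
    · refine (Finset.prod_le_pow_card _ _ _ fun p _ => hle p).trans ?_
      refine Nat.pow_le_pow_right (by omega) ?_
      calc _ ≤ (Finset.Icc 1 (Nat.sqrt (2 * n))).card := Finset.card_le_card fun p hp => by
            simp only [Finset.mem_filter] at hp
            exact Finset.mem_Icc.mpr ⟨hp.1.2.one_lt.le, hp.2⟩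
        _ = _ := by simp
    · refine le_trans ?_ (primorial_le_four_pow (2 * n / 3))
      refine (Finset.prod_le_prod' fun p hp => (?_ : f p ≤ p)).trans ?_
      · simp only [Finset.mem_filter] at hp
        refine (Nat.pow_le_pow_right hp.1.2.pos ?_).trans (pow_one p).le
        exact Nat.factorization_choose_le_one (Nat.sqrt_lt'.mp <| not_le.1 hp.2)
      · refine Finset.prod_le_prod_of_subset_of_one_le' (Finset.filter_subset _ _) ?_
        exact fun p hp _ => (Finset.mem_filter.1 hp).2.one_lt.le
  calc n.centralBinom = _ := hsplit
    _ ≤ ((2 * n) ^ Nat.sqrt (2 * n) * 4 ^ (2 * n / 3)) * (2 * n) ^ P.card :=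
      Nat.mul_le_mul hsmall hlarge
    _ = _ := by ring

theorem mul_pow_sqrt_le_four_pow (n : ℕ) (hn : 8192 ≤ n) :
    n * ((2 * n) ^ (Nat.sqrt (2 * n) + 2) * 4 ^ (2 * n / 3)) ≤ 4 ^ n := by
  set k := Nat.log 4 (2 * n) with hk
  have h1 : 4 ^ k ≤ 2 * n := Nat.pow_log_le_self 4 (by omega)
  have h2 : 2 * n < 4 ^ (k + 1) := Nat.lt_pow_succ_log_self (by norm_num) _
  have hk7 : 7 ≤ k := by
    rw [hk]; exact Nat.le_log_of_pow_le (by norm_num) (by omega)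
  have hs : Nat.sqrt (2 * n) < 2 ^ (k + 1) := by
    rw [Nat.sqrt_lt', ← pow_mul, mul_comm (k + 1), pow_mul]; exact h2
  have hmain : ∀ j : ℕ, 7 ≤ j → 6 * ((j + 1) * (2 ^ (j + 1) + 2)) ≤ 4 ^ j := by
    intro j hj
    induction j, hj using Nat.le_induction with
    | base => norm_num
    | succ j hj ih =>
      have : 1 ≤ 2 ^ j := Nat.one_le_two_pow
      simp only [pow_succ] at ih ⊢
      nlinarith
  have hexp : (k + 1) * (Nat.sqrt (2 * n) + 3) + 2 * n / 3 ≤ n := by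
    have h3 : (k + 1) * (Nat.sqrt (2 * n) + 3) ≤ (k + 1) * (2 ^ (k + 1) + 2) :=
      Nat.mul_le_mul_left _ (by omega)
    have := hmain k hk7
    omega
  calc n * ((2 * n) ^ (Nat.sqrt (2 * n) + 2) * 4 ^ (2 * n / 3))
      ≤ (2 * n) * ((2 * n) ^ (Nat.sqrt (2 * n) + 2) * 4 ^ (2 * n / 3)) := by gcongr; omega
    _ = (2 * n) ^ (Nat.sqrt (2 * n) + 3) * 4 ^ (2 * n / 3) := by ring
    _ ≤ (4 ^ (k + 1)) ^ (Nat.sqrt (2 * n) + 3) * 4 ^ (2 * n / 3) := by gcongr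
    _ = 4 ^ ((k + 1) * (Nat.sqrt (2 * n) + 3) + 2 * n / 3) := by rw [← pow_mul, ← pow_add]
    _ ≤ 4 ^ n := Nat.pow_le_pow_right (by norm_num) hexp

/-- For `n ≥ 9` there are at least three primes strictly between `n` and `2n`. -/
theorem exists_three_primes_lt_two_mul (n : ℕ) (hn : 9 ≤ n) :
    ∃ p q r : ℕ, p.Prime ∧ q.Prime ∧ r.Prime ∧ n < p ∧ p < q ∧ q < r ∧ r < 2 * n := by
  rcases le_or_gt 8192 n with h | h
  · have hcard : 2 < ((Finset.Ioo n (2 * n)).filter Nat.Prime).card := by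
      by_contra! hc
      have h1 := n.four_pow_lt_mul_centralBinom (by omega)
      have h2 := centralBinom_le_pow_card_primes n (by omega)
      have h3 := mul_pow_sqrt_le_four_pow n h
      refine absurd (h1.trans_le ((Nat.mul_le_mul_left n (h2.trans ?_)).trans h3)) (lt_irrefl _)
      gcongr
      omega
    obtain ⟨a, b, c, ha, hb, hc, hab, hac, hbc⟩ := Finset.two_lt_card.1 hcard
    simp only [Finset.mem_filter, Finset.mem_Ioo] at ha hb hc
    grind
  · have key (p q r : ℕ) (hp : p.Prime) (hq : q.Prime) (hr : r.Prime) (hpq : p < q) (hqr : q < r)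
        (hnp : n < p) (hrn : r < 2 * n) :
        ∃ p q r : ℕ, p.Prime ∧ q.Prime ∧ r.Prime ∧ n < p ∧ p < q ∧ q < r ∧ r < 2 * n :=
      ⟨p, q, r, hp, hq, hr, hnp, hpq, hqr, hrn⟩
    rcases lt_or_ge n 11 with h' | h'
    · exact key 11 13 17 (by norm_num) (by norm_num) (by norm_num) (by norm_num) (by norm_num)
        h' (by omega)
    rcases lt_or_ge n 13 with h' | h'
    · exact key 13 17 19 (by norm_num) (by norm_num) (by norm_num) (by norm_num) (by norm_num)
        h' (by omega)
    rcases lt_or_ge n 17 with h' | h'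
    · exact key 17 19 23 (by norm_num) (by norm_num) (by norm_num) (by norm_num) (by norm_num)
        h' (by omega)
    rcases lt_or_ge n 23 with h' | h'
    · exact key 23 29 31 (by norm_num) (by norm_num) (by norm_num) (by norm_num) (by norm_num)
        h' (by omega)
    rcases lt_or_ge n 37 with h' | h'
    · exact key 37 41 43 (by norm_num) (by norm_num) (by norm_num) (by norm_num) (by norm_num)
        h' (by omega)
    rcases lt_or_ge n 67 with h' | h'
    · exact key 67 71 73 (by norm_num) (by norm_num) (by norm_num) (by norm_num) (by norm_num)
        h' (by omega)
    rcases lt_or_ge n 113 with h' | h'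
    · exact key 113 127 131 (by norm_num) (by norm_num) (by norm_num) (by norm_num) (by norm_num)
        h' (by omega)
    rcases lt_or_ge n 199 with h' | h'
    · exact key 199 211 223 (by norm_num) (by norm_num) (by norm_num) (by norm_num) (by norm_num)
        h' (by omega)
    rcases lt_or_ge n 383 with h' | h'
    · exact key 383 389 397 (by norm_num) (by norm_num) (by norm_num) (by norm_num) (by norm_num)
        h' (by omega)
    rcases lt_or_ge n 751 with h' | h'
    · exact key 751 757 761 (by norm_num) (by norm_num) (by norm_num) (by norm_num) (by norm_num)
        h' (by omega)
    rcases lt_or_ge n 1489 with h' | h'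
    · exact key 1489 1493 1499 (by norm_num) (by norm_num) (by norm_num) (by norm_num) (by norm_num)
        h' (by omega)
    rcases lt_or_ge n 2963 with h' | h'
    · exact key 2963 2969 2971 (by norm_num) (by norm_num) (by norm_num) (by norm_num) (by norm_num)
        h' (by omega)
    rcases lt_or_ge n 5897 with h' | h'
    · exact key 5897 5903 5923 (by norm_num) (by norm_num) (by norm_num) (by norm_num) (by norm_num)
        h' (by omega)
    exact key 11779 11783 11789 (by norm_num) (by norm_num) (by norm_num) (by norm_num) (by norm_num)
      (by omega) (by omega)

theorem natCast_catalan_ne_zero (i : ℕ) : (catalan i : ℤ) ≠ 0 := by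
  have h1 := succ_mul_catalan_eq_centralBinom i
  have h2 := i.centralBinom_pos
  intro h
  simp_all

theorem aPoly_coeff (m j : ℕ) :
    (aPoly (m + 1)).coeff j = if j < m then (catalan j : ℤ) else 0 := by
  simp [aPoly, coeff_X_pow]

theorem aPoly_succ (m : ℕ) :
    aPoly (m + 2) = aPoly (m + 1) + C (catalan m : ℤ) * X ^ m := by
  simp [aPoly, Finset.sum_range_succ]

/-- The functional equation of the Catalan generating function, truncated. -/
theorem X_pow_dvd_one_add_X_mul_aPoly_sq_sub (m : ℕ) :
    X ^ m ∣ 1 + X * aPoly (m + 1) ^ 2 - aPoly (m + 1) := by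
  rw [X_pow_dvd_iff]
  rintro (_ | j) hj
  · simp [aPoly_coeff, hj, mul_coeff_zero]
  · rw [coeff_sub, coeff_add, coeff_X_mul, sq, coeff_mul, aPoly_coeff, if_pos hj, catalan_succ',
      coeff_one, if_neg (by omega)]
    push_cast
    rw [zero_add, sub_eq_zero]
    refine Finset.sum_congr rfl fun x hx => ?_
    have := Finset.HasAntidiagonal.mem_antidiagonal.1 hx
    rw [aPoly_coeff, aPoly_coeff, if_pos (by omega), if_pos (by omega)]

theorem X_pow_dvd_one_sub_mul_aPoly_comp (m : ℕ) :
    X ^ m ∣ 1 - (1 - X) * (aPoly (m + 1)).comp (X - X ^ 2) := by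
  obtain ⟨r, hr⟩ := X_pow_dvd_one_add_X_mul_aPoly_sq_sub m
  have h := congrArg (fun f : ℤ[X] => f.comp (X - X ^ 2)) hr
  simp only [sub_comp, add_comp, one_comp, mul_comp, X_comp, pow_comp] at h
  set s := (aPoly (m + 1)).comp (X - X ^ 2)
  have hcop : IsCoprime (X ^ m : ℤ[X]) (1 - X * s) :=
    IsCoprime.pow_left ⟨s, 1, by ring⟩
  refine hcop.dvd_of_dvd_mul_left ⟨(1 - X) ^ m * r.comp (X - X ^ 2), ?_⟩
  have hX : (X - X ^ 2 : ℤ[X]) = X * (1 - X) := by ring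
  rw [← mul_assoc, ← mul_pow, ← hX, ← h]
  ring

theorem X_pow_mul_kPoly_comp {m : ℕ} {k : ℤ[X]}
    (hk : (1 - X) ^ m * k = 1 - X * (aPoly (m + 1)).comp (X - X ^ 2)) :
    X ^ m * k.comp (1 - X) = 1 - (1 - X) * (aPoly (m + 1)).comp (X - X ^ 2) := by
  have h := congrArg (fun f : ℤ[X] => f.comp (1 - X)) hk
  simp only [sub_comp, one_comp, mul_comp, X_comp, pow_comp, comp_assoc] at h
  rw [show (1 - (1 - X) : ℤ[X]) = X by ring,
    show (1 - X - (1 - X) ^ 2 : ℤ[X]) = X - X ^ 2 by ring] at h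
  exact h

/-- The identity exchanging `X` and `1 - X` that determines `k`. -/
theorem kPoly_symm {m : ℕ} {k : ℤ[X]}
    (hk : (1 - X) ^ m * k = 1 - X * (aPoly (m + 1)).comp (X - X ^ 2)) :
    (1 - X) ^ (m + 1) * k - X ^ (m + 1) * k.comp (1 - X) = 1 - 2 * X := by
  have h := X_pow_mul_kPoly_comp hk
  linear_combination (1 - X) * hk - X * h

theorem kPoly_eval_zero {m : ℕ} {k : ℤ[X]}
    (hk : (1 - X) ^ m * k = 1 - X * (aPoly (m + 1)).comp (X - X ^ 2)) : k.eval 0 = 1 := by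
  have h := congrArg (eval 0) hk
  simpa using h

theorem kPoly_eval_one {m : ℕ} {k : ℤ[X]}
    (hk : (1 - X) ^ m * k = 1 - X * (aPoly (m + 1)).comp (X - X ^ 2)) : k.eval 1 = catalan m := by
  have h := X_pow_mul_kPoly_comp hk
  obtain ⟨r, hr⟩ := X_pow_dvd_one_sub_mul_aPoly_comp (m + 1)
  rw [aPoly_succ, add_comp, mul_comp, C_comp, pow_comp, X_comp] at hr
  have hX : (X - X ^ 2 : ℤ[X]) ^ m = X ^ m * (1 - X) ^ m := by rw [← mul_pow]; ring
  rw [hX] at hr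
  have h2 : k.comp (1 - X) = C (catalan m : ℤ) * (1 - X) ^ (m + 1) + X * r :=
    mul_left_cancel₀ (pow_ne_zero m X_ne_zero) (by linear_combination h + hr)
  simpa [eval_comp] using congrArg (eval 0) h2

theorem kPoly_natDegree_and_leadingCoeff {m : ℕ} {k : ℤ[X]}
    (hk : (1 - X) ^ m * k = 1 - X * (aPoly (m + 1)).comp (X - X ^ 2)) (hm : m ≠ 0) :
    k.natDegree = m - 1 ∧ k.leadingCoeff = catalan (m - 1) := by
  obtain ⟨l, rfl⟩ := Nat.exists_eq_succ_of_ne_zero hm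
  have had : (aPoly (l + 2)).natDegree = l := by
    refine natDegree_eq_of_le_of_coeff_ne_zero ?_ ?_
    · rw [natDegree_le_iff_coeff_eq_zero]
      intro N hN
      rw [aPoly_coeff, if_neg (by omega)]
    · rw [aPoly_coeff, if_pos (by omega)]
      exact natCast_catalan_ne_zero l
  have hal : (aPoly (l + 2)).leadingCoeff = catalan l := by
    rw [leadingCoeff, had, aPoly_coeff, if_pos (by omega)]
  have hq : (X - X ^ 2 : ℤ[X]) = -(X ^ 2 - X) := by ring
  have hqd : (X ^ 2 - X : ℤ[X]).natDegree = 2 := by compute_degree!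
  have hqm : (X ^ 2 - X : ℤ[X]).leadingCoeff = 1 := by
    rw [leadingCoeff, hqd]; simp [coeff_X]
  have hd : (X * (aPoly (l + 2)).comp (X - X ^ 2)).natDegree = 2 * l + 1 := by
    rw [natDegree_X_mul, natDegree_comp, had, hq, natDegree_neg, hqd, mul_comm]
    intro h0
    have : ((aPoly (l + 2)).comp (X - X ^ 2)).leadingCoeff = 0 := by simp [h0]
    rw [leadingCoeff_comp (by rw [hq, natDegree_neg, hqd]; norm_num), hal, hq, leadingCoeff_neg,
      hqm] at this
    simp only [ne_eq, mul_eq_zero, pow_eq_zero_iff', natCast_catalan_ne_zero l, false_or] at this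
    norm_num at this
  have hl : (X * (aPoly (l + 2)).comp (X - X ^ 2)).leadingCoeff =
      (catalan l : ℤ) * (-1) ^ l := by
    rw [leadingCoeff_mul, leadingCoeff_X, one_mul,
      leadingCoeff_comp (by rw [hq, natDegree_neg, hqd]; norm_num), hal, had, hq,
      leadingCoeff_neg, hqm]
  have hdeg : (1 : ℤ[X]).degree < (X * (aPoly (l + 2)).comp (X - X ^ 2)).degree := by
    apply degree_lt_degree
    rw [hd]
    simp
  have hX1 : (1 - X : ℤ[X]) = -(X - 1) := by ring
  have hXd : (1 - X : ℤ[X]).natDegree = 1 := by compute_degree!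
  have hXl : (1 - X : ℤ[X]).leadingCoeff = -1 := by
    rw [hX1, leadingCoeff_neg, ← C_1, leadingCoeff_X_sub_C]
  have hk0 : k ≠ 0 := by
    rintro rfl
    simpa using kPoly_eval_zero hk
  have h1 := congrArg natDegree hk
  have h2 := congrArg leadingCoeff hk
  rw [natDegree_mul (pow_ne_zero _ (by intro h; simp [h] at hXd)) hk0, natDegree_pow, hXd,
    natDegree_sub_eq_right_of_natDegree_lt (by rw [hd]; simp), hd] at h1
  rw [leadingCoeff_mul, leadingCoeff_pow, hXl, leadingCoeff_sub_of_degree_lt' hdeg, hl] at h2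
  refine ⟨by omega, ?_⟩
  have hs : ((-1 : ℤ) ^ l) * (-1) ^ l = 1 := by rw [← mul_pow]; simp
  rw [Nat.succ_eq_add_one, Nat.add_sub_cancel]
  rw [Nat.succ_eq_add_one, pow_succ] at h2
  linear_combination (-(-1) ^ l) * h2 + (catalan l - k.leadingCoeff) * hs

/-- Reduction of `k` modulo a prime `p`, one of whose powers lies in `(m, 2m)`. -/
theorem kPoly_map_zmod {m : ℕ} {k : ℤ[X]}
    (hk : (1 - X) ^ m * k = 1 - X * (aPoly (m + 1)).comp (X - X ^ 2)) (hm : m ≠ 0) (p : ℕ) [Fact p.Prime] (s : ℕ) (h1 : m < p ^ s)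
    (h2 : p ^ s < 2 * m) :
    k.map (Int.castRingHom (ZMod p)) = (1 - 2 * X) * (1 - X) ^ (p ^ s - m - 1) := by
  obtain ⟨A, hA⟩ := Nat.exists_eq_add_of_lt h1
  have h := congrArg (Polynomial.map (Int.castRingHom (ZMod p))) (kPoly_symm hk)
  simp only [Polynomial.map_sub, Polynomial.map_mul, Polynomial.map_pow, Polynomial.map_one,
    map_X, Polynomial.map_ofNat] at h
  set kb := k.map (Int.castRingHom (ZMod p))
  set kc := (k.comp (1 - X)).map (Int.castRingHom (ZMod p))
  have hF : (1 - X : (ZMod p)[X]) ^ (p ^ s) = 1 - X ^ (p ^ s) := by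
    rw [sub_pow_char_pow, one_pow]
  rw [show p ^ s - m - 1 = A by omega]
  have hdvd : X ^ (m + 1) ∣ kb - (1 - 2 * X) * (1 - X) ^ A := by
    refine ⟨(1 - X) ^ A * kc + X ^ A * kb, ?_⟩
    have hF' : (1 - X : (ZMod p)[X]) ^ A * (1 - X) ^ (m + 1) = 1 - X ^ A * X ^ (m + 1) := by
      rw [← pow_add, ← pow_add, show A + (m + 1) = p ^ s by omega, hF]
    linear_combination (1 - X) ^ A * h - kb * hF'
  rw [← sub_eq_zero]
  by_contra hne
  have hle := natDegree_le_of_dvd hdvd hne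
  rw [natDegree_X_pow] at hle
  have hkb : kb.natDegree ≤ m - 1 :=
    natDegree_map_le.trans (kPoly_natDegree_and_leadingCoeff hk hm).1.le
  have h1X : (1 - X : (ZMod p)[X]).natDegree ≤ 1 := by compute_degree
  have h2X : (1 - 2 * X : (ZMod p)[X]).natDegree ≤ 1 := by compute_degree
  have hr : ((1 - 2 * X : (ZMod p)[X]) * (1 - X) ^ A).natDegree ≤ 1 + A * 1 :=
    natDegree_mul_le_of_le h2X (natDegree_pow_le_of_le A h1X)
  have := natDegree_sub_le_of_le hkb hr
  omega

theorem natDegree_eq_add_natDegree_map {p : ℕ} [Fact p.Prime] (hp2 : p ≠ 2) {g h : ℤ[X]} {A B : ℕ}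
    (hmap : (g * h).map (Int.castRingHom (ZMod p)) = (1 - 2 * X) * (1 - X) ^ A)
    (hdeg : (g * h).natDegree = A + 1 + B) (hh : ¬ (p : ℤ) ∣ h.leadingCoeff) :
    g.natDegree = B + (g.map (Int.castRingHom (ZMod p))).natDegree := by
  have h2 : (2 : ZMod p) ≠ 0 := by
    intro h0
    have : ((2 : ℕ) : ZMod p) = 0 := by exact_mod_cast h0
    rw [ZMod.natCast_eq_zero_iff] at this
    exact hp2 ((Nat.prime_dvd_prime_iff_eq Fact.out Nat.prime_two).1 this)
  have hd2 : (1 - 2 * X : (ZMod p)[X]).natDegree = 1 := by compute_degree!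
  have hd1 : (1 - X : (ZMod p)[X]).natDegree = 1 := by compute_degree!
  have hn2 : (1 - 2 * X : (ZMod p)[X]) ≠ 0 := by intro h; simp [h] at hd2
  have hn1 : (1 - X : (ZMod p)[X]) ^ A ≠ 0 := by
    refine pow_ne_zero _ ?_; intro h; simp [h] at hd1
  have hgh : g * h ≠ 0 := ne_zero_of_natDegree_gt (n := 0) (by omega)
  rw [natDegree_mul (left_ne_zero_of_mul hgh) (right_ne_zero_of_mul hgh)] at hdeg
  have hhd : (h.map (Int.castRingHom (ZMod p))).natDegree = h.natDegree := by
    apply natDegree_map_of_leadingCoeff_ne_zero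
    simpa [ZMod.intCast_zmod_eq_zero_iff_dvd] using hh
  have hne : (g * h).map (Int.castRingHom (ZMod p)) ≠ 0 := by
    rw [hmap]; exact mul_ne_zero hn2 hn1
  have hcd := congrArg natDegree hmap
  rw [Polynomial.map_mul] at hne hcd
  rw [natDegree_mul (left_ne_zero_of_mul hne) (right_ne_zero_of_mul hne), hhd,
    natDegree_mul hn2 hn1, natDegree_pow, hd2, hd1] at hcd
  omega

theorem le_natDegree_map_of_mul_eq {p : ℕ} [Fact p.Prime] {g h : ℤ[X]} {A : ℕ}
    (hne : (g * h).map (Int.castRingHom (ZMod p)) ≠ 0)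
    (hdvd : (1 - X) ^ A ∣ (g * h).map (Int.castRingHom (ZMod p))) (hh : ¬ (p : ℤ) ∣ h.eval 1) :
    A ≤ (g.map (Int.castRingHom (ZMod p))).natDegree := by
  rw [Polynomial.map_mul] at hne hdvd
  have hcop : IsCoprime ((X - C 1) ^ A : (ZMod p)[X]) (h.map (Int.castRingHom (ZMod p))) := by
    refine IsCoprime.pow_left ((irreducible_X_sub_C (1 : ZMod p)).coprime_iff_not_dvd.2 ?_)
    rw [dvd_iff_isRoot, IsRoot.def, eval_one_map]
    simpa [ZMod.intCast_zmod_eq_zero_iff_dvd] using hh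
  have hd : ((X - C 1) ^ A : (ZMod p)[X]) ∣ g.map (Int.castRingHom (ZMod p)) := by
    refine hcop.dvd_of_dvd_mul_right (dvd_trans ?_ hdvd)
    exact pow_dvd_pow_of_dvd ⟨-1, by rw [C_1]; ring⟩ A
  have := natDegree_le_of_dvd hd (left_ne_zero_of_mul hne)
  rwa [natDegree_pow, natDegree_X_sub_C, mul_one] at this

/-- If a product of integers is not divisible by `p²`, one of the factors is prime to `p`. -/
theorem not_dvd_or_not_dvd_of_not_sq_dvd {p a b : ℤ} (h : ¬ p ^ 2 ∣ a * b) : ¬ p ∣ a ∨ ¬ p ∣ b := by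
  by_contra! hc
  exact h (sq p ▸ mul_dvd_mul hc.1 hc.2)

/-- The roots of such an `f` over `ℚ_p` fall into indecomposable blocks of sizes `A`, `1` and `B`
(near `1`, `1/2` and `∞` respectively), which restricts the degrees of the factors of `f`. -/
theorem natDegree_factor_of_map_eq {p : ℕ} [Fact p.Prime] (hp2 : p ≠ 2) {g h : ℤ[X]} {A B : ℕ}
    (hmap : (g * h).map (Int.castRingHom (ZMod p)) = (1 - 2 * X) * (1 - X) ^ A)
    (hdeg : (g * h).natDegree = A + 1 + B)
    (hl : ¬ (p : ℤ) ^ 2 ∣ (g * h).leadingCoeff) (h1 : ¬ (p : ℤ) ^ 2 ∣ (g * h).eval 1) :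
    g.natDegree ≤ 1 ∨ h.natDegree ≤ 1 ∨ g.natDegree = A ∨ g.natDegree = A + 1 ∨
      g.natDegree = B ∨ g.natDegree = B + 1 := by
  have hgh : g * h ≠ 0 := ne_zero_of_natDegree_gt (n := 0) (by omega)
  have hsum : g.natDegree + h.natDegree = A + 1 + B := by
    rw [← hdeg, natDegree_mul (left_ne_zero_of_mul hgh) (right_ne_zero_of_mul hgh)]
  have hne : (g * h).map (Int.castRingHom (ZMod p)) ≠ 0 := by
    intro h0
    have := congrArg (eval 0) (hmap.symm.trans h0)
    simp at this
  have hdvd : (1 - X) ^ A ∣ (g * h).map (Int.castRingHom (ZMod p)) := hmap ▸ dvd_mul_left _ _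
  have hmap' := mul_comm g h ▸ hmap
  have hdeg' := mul_comm g h ▸ hdeg
  have hne' := mul_comm g h ▸ hne
  have hdvd' := mul_comm g h ▸ hdvd
  rw [leadingCoeff_mul] at hl
  rw [eval_mul] at h1
  have hg := natDegree_map_le (f := Int.castRingHom (ZMod p)) (p := g)
  have hh := natDegree_map_le (f := Int.castRingHom (ZMod p)) (p := h)
  rcases not_dvd_or_not_dvd_of_not_sq_dvd hl with hl | hl <;>
    rcases not_dvd_or_not_dvd_of_not_sq_dvd h1 with h1 | h1
  · have := natDegree_eq_add_natDegree_map hp2 hmap' hdeg' hl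
    have := le_natDegree_map_of_mul_eq hne' hdvd' h1
    omega
  · have := natDegree_eq_add_natDegree_map hp2 hmap' hdeg' hl
    have := le_natDegree_map_of_mul_eq hne hdvd h1
    omega
  · have := natDegree_eq_add_natDegree_map hp2 hmap hdeg hl
    have := le_natDegree_map_of_mul_eq hne' hdvd' h1
    omega
  · have := natDegree_eq_add_natDegree_map hp2 hmap hdeg hl
    have := le_natDegree_map_of_mul_eq hne hdvd h1
    omega

theorem sum_catalan_div_four_pow (m : ℕ) :
    ∑ i ∈ Finset.range m, (catalan i : ℚ) * (1 / 4) ^ i =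
      2 - 2 * (m.centralBinom * (1 / 4) ^ m) := by
  induction m with
  | zero => simp
  | succ m ih =>
    rw [Finset.sum_range_succ, ih]
    have h1 : ((m : ℚ) + 1) * catalan m = m.centralBinom := by
      exact_mod_cast succ_mul_catalan_eq_centralBinom m
    have h2 : ((m : ℚ) + 1) * (m + 1).centralBinom = 2 * (2 * m + 1) * m.centralBinom := by
      exact_mod_cast Nat.succ_mul_centralBinom_succ m
    have h3 : ((m + 1).centralBinom : ℚ) = 2 * (2 * m + 1) * catalan m := by
      have : (m : ℚ) + 1 ≠ 0 := by positivity
      apply mul_left_cancel₀ this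
      linear_combination h2 - 2 * (2 * (m : ℚ) + 1) * h1
    rw [h3, ← h1, pow_succ]
    ring

theorem abs_aeval_aPoly_lt_two (m : ℕ) {w : ℚ} (hw : |w| ≤ 1 / 4) :
    |aeval w (aPoly (m + 1))| < 2 := by
  have h : aeval w (aPoly (m + 1)) = ∑ i ∈ Finset.range m, (catalan i : ℚ) * w ^ i := by
    simp [aPoly]
  rw [h]
  calc |∑ i ∈ Finset.range m, (catalan i : ℚ) * w ^ i|
      ≤ ∑ i ∈ Finset.range m, |(catalan i : ℚ) * w ^ i| := Finset.abs_sum_le_sum_abs _ _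
    _ ≤ ∑ i ∈ Finset.range m, (catalan i : ℚ) * (1 / 4) ^ i := by
      gcongr with i
      rw [abs_mul, abs_pow, Nat.abs_cast]
      gcongr
    _ < 2 := by
      rw [sum_catalan_div_four_pow]
      have := m.centralBinom_pos
      have : (0 : ℚ) < m.centralBinom * (1 / 4) ^ m := by positivity
      linarith

/-- If `1/y` is a root of `k` for an integer `y`, then `-4 ≤ y ≤ 1`. -/
theorem kPoly_root_bound {m : ℕ} {k : ℤ[X]}
    (hk : (1 - X) ^ m * k = 1 - X * (aPoly (m + 1)).comp (X - X ^ 2)) {y : ℤ}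
    (hy : aeval ((y : ℚ)⁻¹) k = 0) : -4 ≤ y ∧ y ≤ 1 := by
  by_contra hc
  have hc' : y ≤ -5 ∨ 2 ≤ y := by omega
  have hroot := congrArg (aeval ((y : ℚ)⁻¹)) hk
  simp only [map_mul, map_sub, map_one, map_pow, aeval_X, aeval_comp, hy, mul_zero] at hroot
  have hy0 : (y : ℚ) ≠ 0 := by
    have : y ≠ 0 := by omega
    exact_mod_cast this
  have hpoly : |(y : ℚ) - 1| * 4 ≤ (y : ℚ) ^ 2 := by
    have : |y - 1| * 4 ≤ y ^ 2 := by
      rcases hc' with h | h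
      · rw [abs_of_neg (by omega)]; nlinarith
      · rw [abs_of_pos (by omega)]; nlinarith [sq_nonneg (y - 2)]
    exact_mod_cast this
  have hw : |(y : ℚ)⁻¹ - (y : ℚ)⁻¹ ^ 2| ≤ 1 / 4 := by
    have : (y : ℚ)⁻¹ - (y : ℚ)⁻¹ ^ 2 = (y - 1) / y ^ 2 := by field_simp
    rw [this, abs_div, abs_of_nonneg (sq_nonneg (y : ℚ)), div_le_iff₀ (by positivity)]
    linarith
  have ha := abs_aeval_aPoly_lt_two m hw
  have hy2 : (2 : ℚ) ≤ |(y : ℚ)| := by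
    have : 2 ≤ |y| := by grind
    exact_mod_cast this
  have hval : aeval ((y : ℚ)⁻¹ - (y : ℚ)⁻¹ ^ 2) (aPoly (m + 1)) = y := by
    field_simp at hroot ⊢
    linear_combination hroot
  rw [hval] at ha
  linarith

theorem aeval_inv_eq_zero_of_linear_factor {F : Type*} [Field F] {g h : ℤ[X]} {y : ℤ}
    (hg : g = C (g.coeff 0) * (1 - C y * X)) (hy : (y : F) ≠ 0) :
    aeval ((y : F)⁻¹) (g * h) = 0 := by
  rw [map_mul, hg]
  simp [hy]

theorem exists_prime_ge_seven_lt_two_mul (m : ℕ) (hm : 4 ≤ m) :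
    ∃ p : ℕ, p.Prime ∧ 7 ≤ p ∧ m < p ∧ p < 2 * m := by
  rcases lt_or_ge m 6 with h | h
  · exact ⟨7, by norm_num, le_rfl, by omega, by omega⟩
  · obtain ⟨p, hp, h1, h2⟩ := Nat.exists_prime_lt_and_le_two_mul m (by omega)
    refine ⟨p, hp, by omega, h1, lt_of_le_of_ne h2 ?_⟩
    rintro rfl
    exact Nat.not_prime_mul (by norm_num) (by omega) hp

theorem kPoly_natDegree_ne_one_of_mul {m : ℕ} {k : ℤ[X]}
    (hk : (1 - X) ^ m * k = 1 - X * (aPoly (m + 1)).comp (X - X ^ 2)) (hm : 3 ≤ m) {g h : ℤ[X]}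
    (hgh : k = g * h) : g.natDegree ≠ 1 := by
  intro hg
  have hunit : g.coeff 0 * h.eval 0 = 1 := by
    rw [coeff_zero_eq_eval_zero, ← eval_mul, ← hgh, kPoly_eval_zero hk]
  have hsq : g.coeff 0 * g.coeff 0 = 1 := Int.isUnit_mul_self (.of_mul_eq_one _ hunit)
  obtain ⟨y, hy⟩ : ∃ y, y = -(g.coeff 0 * g.coeff 1) := ⟨_, rfl⟩
  have hgy : g = C (g.coeff 0) * (1 - C y * X) := by
    conv_lhs => rw [eq_X_add_C_of_natDegree_le_one hg.le]
    have h2 : (C (g.coeff 0) * C (g.coeff 0) : ℤ[X]) = 1 := by rw [← C_mul, hsq, C_1]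
    rw [hy, C_neg, C_mul]
    linear_combination (-(C (g.coeff 1) * X)) * h2
  have hy0 : y ≠ 0 := by
    rintro rfl
    rw [hgy] at hg
    simp at hg
  have hy1 : y ≠ 1 := by
    rintro rfl
    have h1 := kPoly_eval_one hk
    rw [hgh, eval_mul, hgy] at h1
    simp only [eval_mul, eval_sub, eval_one, eval_X, eval_C, one_mul, sub_self, mul_zero,
      zero_mul] at h1
    exact natCast_catalan_ne_zero m h1.symm
  have hroot : aeval ((y : ℚ)⁻¹) k = 0 :=
    hgh ▸ aeval_inv_eq_zero_of_linear_factor hgy (by exact_mod_cast hy0)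
  obtain ⟨hl, hu⟩ := kPoly_root_bound hk hroot
  rcases hm.eq_or_lt with rfl | hm
  · have h0 := congrArg (aeval ((y : ℚ)⁻¹)) hk
    simp only [map_mul, map_sub, map_one, map_pow, aeval_X, aeval_comp, hroot, mul_zero] at h0
    have hneg : (y : ℚ)⁻¹ < 0 := inv_lt_zero.2 (by exact_mod_cast (by omega : y < 0))
    set x := (y : ℚ)⁻¹
    have ha : aeval (x - x ^ 2) (aPoly (3 + 1)) = 1 + (x - x ^ 2) + 2 * (x - x ^ 2) ^ 2 := by
      simp [aPoly, Finset.sum_range_succ, catalan_two, map_ofNat (aeval (x - x ^ 2)) 2]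
    rw [ha] at h0
    nlinarith [sq_nonneg (1 + 4 * (x - x ^ 2))]
  · obtain ⟨p, hp, hp7, h1, h2⟩ := exists_prime_ge_seven_lt_two_mul m hm
    have : Fact p.Prime := ⟨hp⟩
    have hyp : (y : ZMod p) ≠ 0 := by
      rw [Ne, ZMod.intCast_zmod_eq_zero_iff_dvd, ← dvd_neg]
      intro h
      have := Int.le_of_dvd (by omega) h
      omega
    have hr : aeval ((y : ZMod p)⁻¹) k = 0 := hgh ▸ aeval_inv_eq_zero_of_linear_factor hgy hyp
    have hmap := kPoly_map_zmod hk (by omega) p 1 (by simpa using h1) (by simpa using h2)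
    rw [aeval_def, eval₂_eq_eval_map, algebraMap_int_eq, hmap, eval_mul, mul_eq_zero,
      eval_pow] at hr
    have hdvd : (p : ℤ) ∣ 2 - y ∨ (p : ℤ) ∣ 1 - y := by
      rcases hr with hr | hr
      · left
        rw [← ZMod.intCast_zmod_eq_zero_iff_dvd]
        simp only [eval_sub, eval_one, eval_mul, eval_ofNat, eval_X] at hr
        field_simp at hr
        push_cast
        linear_combination -hr
      · right
        have hr := eq_zero_of_pow_eq_zero hr
        rw [← ZMod.intCast_zmod_eq_zero_iff_dvd]
        simp only [eval_sub, eval_one, eval_X] at hr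
        field_simp at hr
        push_cast
        linear_combination -hr
    rcases hdvd with h | h
    · have := Int.le_of_dvd (by omega) h
      omega
    · have := Int.le_of_dvd (by omega) h
      omega

theorem not_sq_dvd_catalan {p m : ℕ} (hp : p.Prime) (h : 2 * m < p ^ 2) :
    ¬ p ^ 2 ∣ catalan m := by
  intro hd
  have h1 : p ^ 2 ∣ m.centralBinom :=
    succ_mul_catalan_eq_centralBinom m ▸ hd.mul_left (m + 1)
  rw [hp.pow_dvd_iff_le_factorization m.centralBinom_ne_zero] at h1
  have h2 : m.centralBinom.factorization p ≤ 1 := Nat.factorization_choose_le_one h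
  omega

theorem kPoly_factor_natDegree {m : ℕ} {k : ℤ[X]}
    (hk : (1 - X) ^ m * k = 1 - X * (aPoly (m + 1)).comp (X - X ^ 2)) {g h : ℤ[X]}
    (hgh : k = g * h) (hg : 2 ≤ g.natDegree) (hh : 2 ≤ h.natDegree) {p s : ℕ} (hp : p.Prime)
    (hp2 : p ≠ 2) (h1 : m < p ^ s) (h2 : p ^ s < 2 * m) (hc : ¬ p ^ 2 ∣ catalan m)
    (hc' : ¬ p ^ 2 ∣ catalan (m - 1)) :
    g.natDegree + m + 1 = p ^ s ∨ g.natDegree + m = p ^ s ∨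
      g.natDegree + p ^ s + 1 = 2 * m ∨ g.natDegree + p ^ s = 2 * m := by
  have : Fact p.Prime := ⟨hp⟩
  have hm : m ≠ 0 := by omega
  obtain ⟨hd, hl⟩ := kPoly_natDegree_and_leadingCoeff hk hm
  have hmap := kPoly_map_zmod hk hm p s h1 h2
  have he := kPoly_eval_one hk
  rw [hgh] at hd hl hmap he
  have := natDegree_factor_of_map_eq hp2 hmap (B := 2 * m - 1 - p ^ s) (by omega)
    (by rw [hl]; exact_mod_cast hc') (by rw [he]; exact_mod_cast hc)
  omega

theorem kPoly_not_mul_of_two_le_natDegree {m : ℕ} {k : ℤ[X]}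
    (hk : (1 - X) ^ m * k = 1 - X * (aPoly (m + 1)).comp (X - X ^ 2)) (hm : m ≠ 0) {g h : ℤ[X]}
    (hgh : k = g * h) (hg : 2 ≤ g.natDegree) (hh : 2 ≤ h.natDegree) : False := by
  have hsum : g.natDegree + h.natDegree = m - 1 := by
    rw [← (kPoly_natDegree_and_leadingCoeff hk hm).1, hgh, natDegree_mul]
    · rintro rfl; simp at hg
    · rintro rfl; simp at hh
  have hprime {p : ℕ} (hp : p.Prime) (h1 : m < p) (h2 : p < 2 * m) :
      g.natDegree + m + 1 = p ∨ g.natDegree + m = p ∨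
        g.natDegree + p + 1 = 2 * m ∨ g.natDegree + p = 2 * m := by
    have := kPoly_factor_natDegree hk hgh hg hh (s := 1) hp (by omega) (by simpa using h1)
      (by simpa using h2) (not_sq_dvd_catalan hp (by nlinarith))
      (not_sq_dvd_catalan hp (by nlinarith [Nat.sub_le m 1]))
    simpa using this
  have hcat (i : ℕ) : catalan i = (2 * i).choose i / (i + 1) := catalan_eq_centralBinom_div i
  have h3 (hc : ¬ 3 ^ 2 ∣ catalan m) (hc' : ¬ 3 ^ 2 ∣ catalan (m - 1)) (h1 : m < 9)
      (h2 : 9 < 2 * m) := kPoly_factor_natDegree hk hgh hg hh (s := 2) Nat.prime_three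
      (by norm_num) (by omega) (by omega) hc hc'
  rcases le_or_gt 9 m with h9 | h9
  · obtain ⟨p, q, r, hp, hq, hr, h1, h2, h3, h4⟩ := exists_three_primes_lt_two_mul m h9
    have hp' := hp.odd_of_ne_two (by omega)
    have hq' := hq.odd_of_ne_two (by omega)
    have hr' := hr.odd_of_ne_two (by omega)
    rw [Nat.odd_iff] at hp' hq' hr'
    have := hprime hp (by omega) (by omega)
    have := hprime hq (by omega) (by omega)
    have := hprime hr (by omega) (by omega)
    omega
  · obtain rfl | rfl | rfl | rfl : m = 5 ∨ m = 6 ∨ m = 7 ∨ m = 8 := by omega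
    · have := h3 (by rw [hcat]; decide) (by rw [hcat]; decide) (by omega) (by omega)
      omega
    · have := hprime (p := 11) (by norm_num) (by omega) (by omega)
      omega
    · have := hprime (p := 13) (by norm_num) (by omega) (by omega)
      omega
    · have := h3 (by rw [hcat]; decide) (by rw [hcat]; decide) (by omega) (by omega)
      omega

theorem kPoly_irreducible_int {m : ℕ} {k : ℤ[X]}
    (hk : (1 - X) ^ m * k = 1 - X * (aPoly (m + 1)).comp (X - X ^ 2)) (hm : 3 ≤ m) :
    Irreducible k := by
  have hd := (kPoly_natDegree_and_leadingCoeff hk (by omega)).1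
  have h0 := kPoly_eval_zero hk
  refine ⟨fun hu => ?_, fun g h hgh => ?_⟩
  · have := natDegree_eq_zero_of_isUnit hu
    omega
  · have hunit : g.eval 0 * h.eval 0 = 1 := by rw [← eval_mul, ← hgh, h0]
    have key {f : ℤ[X]} (hf : IsUnit (f.eval 0)) (hf0 : f.natDegree = 0) : IsUnit f := by
      rw [eq_C_of_natDegree_eq_zero hf0, isUnit_C, coeff_zero_eq_eval_zero]
      exact hf
    by_contra! hc
    have hg0 : g.natDegree ≠ 0 := fun h => hc.1 (key (.of_mul_eq_one _ hunit) h)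
    have hh0 : h.natDegree ≠ 0 := fun h => hc.2 (key (.of_mul_eq_one_right _ hunit) h)
    have hg1 := kPoly_natDegree_ne_one_of_mul hk hm hgh
    have hh1 := kPoly_natDegree_ne_one_of_mul hk hm (hgh.trans (mul_comm g h))
    exact kPoly_not_mul_of_two_le_natDegree hk (by omega) hgh (by omega) (by omega)

/-- for `n ≥ 4`, the polynomial `k⁽ⁿ⁾` with
`(1-X)^(n-1)·k(X) = 1 - X·a⁽ⁿ⁾(X-X²)` has degree `n-2` and is irreducible over ℚ. -/
theorem kPoly_irreducible (n : ℕ) (hn : 4 ≤ n) (k : Polynomial ℤ)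
    (hk : (1 - Polynomial.X) ^ (n - 1) * k =
      1 - Polynomial.X * (aPoly n).comp (Polynomial.X - Polynomial.X ^ 2)) :
    k.natDegree = n - 2 ∧ Irreducible (k.map (Int.castRingHom ℚ)) := by
  obtain ⟨m, rfl⟩ : ∃ m, n = m + 1 := ⟨n - 1, by omega⟩
  rw [Nat.add_sub_cancel] at hk
  have h0 := kPoly_eval_zero hk
  refine ⟨by rw [(kPoly_natDegree_and_leadingCoeff hk (by omega)).1]; omega, ?_⟩
  have hprim : k.IsPrimitive := fun r hr => by
    refine isUnit_of_dvd_one ?_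
    rw [← h0, ← coeff_zero_eq_eval_zero]
    exact (C_dvd_iff_dvd_coeff r k).1 hr 0
  exact (IsPrimitive.Int.irreducible_iff_irreducible_map_cast hprim).1 (kPoly_irreducible_int hk (by omega))
end

section
/- Let n ≥ 2 be an integer, let a⁽ⁿ⁾(X) = ∑_{i=0}^{n−2} Cᵢ·Xⁱ ∈ ℤ[X] where Cᵢ is the i-th Catalan number, and suppose b, h, k ∈ ℤ[X] satisfy X^(n−1)·b(X) = X·a⁽ⁿ⁾(X)² − a⁽ⁿ⁾(X) + 1, X^(n−1)·h(X) = (1−X)·a⁽ⁿ⁾(X−X²) − 1, and k(X) = −h(1−X). For integers c and t, define f̃(X) := Xⁿ + c^(n−1)·t·k(X) and g̃(X) := Xⁿ + c^(n−1)·t·(1 − 2X·a⁽ⁿ⁾(X)) + (c^(n−1)·t)²·b(X). Then g̃(X−X²) = f̃(X)·f̃(1−X) in ℤ[X]. -/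
open Polynomial

/-- with `b, h, k` as indicated and
`f̃ = Xⁿ + c^(n-1)t·k(X)`,
`g̃ = Xⁿ + c^(n-1)t·(1 - 2X·a⁽ⁿ⁾(X)) + (c^(n-1)t)²·b(X)`, one has
`g̃(X-X²) = f̃(X)·f̃(1-X)` in `ℤ[X]`. -/
theorem fg_tilde_relation (n : ℕ) (hn : 2 ≤ n) (b h k : Polynomial ℤ) (c t : ℤ)
    (hb : Polynomial.X ^ (n - 1) * b =
      Polynomial.X * (aPoly n) ^ 2 - aPoly n + 1)
    (hh : Polynomial.X ^ (n - 1) * h =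
      (1 - Polynomial.X) * (aPoly n).comp (Polynomial.X - Polynomial.X ^ 2) - 1)
    (hk : k = - h.comp (1 - Polynomial.X)) :
    (Polynomial.X ^ n
        + Polynomial.C (c ^ (n - 1) * t) * (1 - 2 * Polynomial.X * aPoly n)
        + Polynomial.C ((c ^ (n - 1) * t) ^ 2) * b).comp
        (Polynomial.X - Polynomial.X ^ 2)
      = (Polynomial.X ^ n + Polynomial.C (c ^ (n - 1) * t) * k) *
        (Polynomial.X ^ n + Polynomial.C (c ^ (n - 1) * t) * k).comp
          (1 - Polynomial.X) := by
  obtain ⟨m, rfl⟩ : ∃ m, n = m + 1 := ⟨n - 1, by omega⟩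
  simp only [Nat.add_sub_cancel] at hb hh ⊢
  have hinv : (X - X ^ 2 : ℤ[X]).comp (1 - X) = X - X ^ 2 := by
    simp only [sub_comp, X_comp, pow_comp]
    ring
  have hinvol : (1 - X : ℤ[X]).comp (1 - X) = X := by simp
  have hb' := congrArg (fun p => p.comp (X - X ^ 2)) hb
  have hh' := congrArg (fun p => p.comp (1 - X)) hh
  simp only [mul_comp, pow_comp, X_comp, add_comp, sub_comp, one_comp] at hb'
  simp only [mul_comp, pow_comp, X_comp, sub_comp (p := _ * _), one_comp, comp_assoc, hinv,
    hinvol] at hh'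
  have hX : (X - X ^ 2 : ℤ[X]) ^ m ≠ 0 := by
    refine pow_ne_zero _ fun h0 => ?_
    have := congrArg (fun p => p.eval 2) h0
    norm_num at this
  have hfactor : (X - X ^ 2 : ℤ[X]) = X * (1 - X) := by ring
  have hprod : b.comp (X - X ^ 2) = h * h.comp (1 - X) := by
    apply mul_left_cancel₀ hX
    rw [hb']
    generalize (aPoly (m + 1)).comp (X - X ^ 2) = A at *
    rw [hfactor, mul_pow]
    linear_combination -(1 - X) ^ m * h.comp (1 - X) * hh - ((1 - X) * A - 1) * hh'
  subst hk
  simp only [mul_comp, pow_comp, X_comp, add_comp, sub_comp (p := (1 : ℤ[X])) (q := _ * _),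
    one_comp, neg_comp, C_comp, comp_assoc, hinvol, comp_X, hprod, ofNat_comp]
  generalize (aPoly (m + 1)).comp (X - X ^ 2) = A at *
  rw [hfactor] at *
  simp only [C_pow, mul_pow, C_mul]
  linear_combination C c ^ m * C t * (X * hh + (1 - X) * hh')
end
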